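/- The set of integers b ≥ 2 for which there exist positive integers y and c with 1 ≤ c < b and y² = c·(b³ + b² + b + 1) is infinite. -/

import Mathlib

lemma pell_aux (n : ℕ) : ∃ k s : ℕ, n < k ∧ 0 < s ∧ 2 * k ^ 2 + 2 * k + 1 = s ^ 2 := by
  induction n with
  | zero => exact ⟨3, 5, by norm_num, by norm_num, by norm_num⟩
  | succ n ih =>
    obtain ⟨k, s, hk, hs, h⟩ := ih
    exact ⟨3 * k + 1 + 2 * s, 4 * k + 2 + 3 * s, by omega, by omega, by linarith⟩

theorem infinitely_many_bases_241 :
    {b : ℕ | 2 ≤ b ∧ ∃ y c : ℕ, 0 < y ∧ 1 ≤ c ∧ c < b ∧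
      y ^ 2 = c * (b ^ 3 + b ^ 2 + b + 1)}.Infinite := by
  apply Set.infinite_of_not_bddAbove
  rintro ⟨N, hN⟩
  obtain ⟨k, s, hk, hs, h⟩ := pell_aux N
  have hb := @hN (2 * k + 1) ⟨by omega, (2 * k + 2) * s, k + 1, by positivity, by omega, by omega, by
    rw [mul_pow, ← h]; ring⟩
  omega
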